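/- For every natural number n, the following identity of polynomials in y and q holds: Σ_{σ ∈ S_n} y^{wex(σ)} q^{cro(σ)} = Σ over Motzkin paths P of length n of (Π over up steps of P starting at height h of y·[h+1]_q) · (Π over level steps of P starting at height h of ([h]_q + y·[h+1]_q)) · (Π over down steps of P starting at height h of [h]_q), where [h]_q = 1+q+…+q^{h-1}. -/

import Mathlib

open Finset

inductive Step : Type
  | U | L | D
deriving DecidableEq

instance : Fintype Step where
  elems := Finset.mk (([Step.U, Step.L, Step.D] : List Step) : Multiset Step) (by decide)
  complete := by
    intro x
    cases x <;> decide

/-- The vertical displacement of a step: up = +1, level = 0, down = -1. -/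
def Step.val : Step → ℤ
  | .U => 1
  | .L => 0
  | .D => -1

/-- The partial sum of the step values of the first `i` steps;
this is the height at which step `i` starts. -/
def hsum {n : ℕ} (P : Fin n → Step) (i : ℕ) : ℤ :=
  ∑ j ∈ Finset.univ.filter (fun j : Fin n => (j : ℕ) < i), (P j).val

/-- A Motzkin path: all partial sums nonnegative and total sum 0. -/
abbrev IsMotzkin {n : ℕ} (P : Fin n → Step) : Prop :=
  (∀ i : Fin (n+1), 0 ≤ hsum P (i : ℕ)) ∧ hsum P n = 0

/-- A Motzkin prefix of final height `k`: all partial sums nonnegative, total sum `k`. -/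
abbrev IsMPrefix {n : ℕ} (P : Fin n → Step) (k : ℕ) : Prop :=
  (∀ i : Fin (n+1), 0 ≤ hsum P (i : ℕ)) ∧ hsum P n = (k : ℤ)

/-- `[h]_q = 1 + q + ... + q^(h-1)`. -/
def geo {R : Type*} [CommSemiring R] (q : R) (h : ℤ) : R :=
  ∑ i ∈ Finset.range h.toNat, q ^ i

/-- The Gaussian (q-)binomial coefficient, via the q-Pascal recurrence. -/
def qbinom {R : Type*} [CommSemiring R] (q : R) : ℕ → ℕ → R
  | _, 0 => 1
  | 0, _+1 => 0
  | n+1, k+1 => qbinom q n k + q ^ (k+1) * qbinom q n (k+1)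

/-- The binomial coefficient with integer lower argument, zero on negative arguments. -/
def ch (m : ℕ) (j : ℤ) : ℤ := if 0 ≤ j then m.choose j.toNat else 0

/-- The number of weak exceedances of a permutation: indices `i` with `σ i ≥ i`. -/
def wex {n : ℕ} (σ : Equiv.Perm (Fin n)) : ℕ :=
  (Finset.univ.filter (fun i : Fin n => i ≤ σ i)).card

/-- The number of crossings of a permutation: pairs `(i,k)` with
`i < k ≤ σ i < σ k` or `σ i < σ k < i < k`. -/
def croPerm {n : ℕ} (σ : Equiv.Perm (Fin n)) : ℕ :=
  (Finset.univ.filter (fun p : Fin n × Fin n =>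
    (p.1 < p.2 ∧ p.2 ≤ σ p.1 ∧ σ p.1 < σ p.2) ∨
    (σ p.1 < σ p.2 ∧ σ p.2 < p.1 ∧ p.1 < p.2))).card

namespace Pf

open Classical in
noncomputable def PI (a b : ℕ) : Finset (Finset (ℕ × ℕ)) :=
  (range a ×ˢ range b).powerset.filter
    (fun R => ∀ i v i' v', (i,v) ∈ R → (i',v') ∈ R → (i = i' ↔ v = v'))

lemma mem_PI {a b : ℕ} {R : Finset (ℕ × ℕ)} : R ∈ PI a b ↔
    (∀ i v, (i,v) ∈ R → i < a ∧ v < b) ∧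
    (∀ i v i' v', (i,v) ∈ R → (i',v') ∈ R → (i = i' ↔ v = v')) := by
  classical
  unfold PI
  rw [mem_filter, mem_powerset]
  refine and_congr_left fun _ => ⟨fun h i v hp => by simpa using h hp, fun h p hp => by
    simpa using h p.1 p.2 hp⟩

open Classical in
noncomputable def ov (b : ℕ) (R : Finset (ℕ × ℕ)) : Finset ℕ :=
  (range b).filter (fun v => ∀ i, (i,v) ∉ R)

open Classical in
noncomputable def op (a : ℕ) (R : Finset (ℕ × ℕ)) : Finset ℕ :=
  (range a).filter (fun i => ∀ v, (i,v) ∉ R)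

lemma mem_ov {b : ℕ} {R : Finset (ℕ × ℕ)} {v : ℕ} : v ∈ ov b R ↔ v < b ∧ ∀ i, (i,v) ∉ R := by
  simp [ov]
lemma mem_op {b : ℕ} {R : Finset (ℕ × ℕ)} {v : ℕ} : v ∈ op b R ↔ v < b ∧ ∀ i, (v,i) ∉ R := by
  simp [op]

lemma card_op {a b : ℕ} {R : Finset (ℕ × ℕ)} (hR : R ∈ PI a b) : (op a R).card + R.card = a := by
  rw [mem_PI] at hR
  have h1 : (R.image Prod.fst).card = R.card := by
    apply card_image_of_injOn
    rintro ⟨i, v⟩ hp ⟨i', v'⟩ hp' h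
    have := hR.2 i v i' v' hp hp'
    simp_all
  have h2 : op a R = range a \ R.image Prod.fst := by
    ext k; simp [mem_op]
  have h3 : R.image Prod.fst ⊆ range a := by
    intro k; simp only [mem_image, mem_range]; rintro ⟨⟨i,v⟩, hp, rfl⟩; exact (hR.1 _ _ hp).1
  rw [h2, ← h1, card_sdiff_add_card_eq_card h3, card_range]

lemma card_ov {a b : ℕ} {R : Finset (ℕ × ℕ)} (hR : R ∈ PI a b) : (ov b R).card + R.card = b := by
  rw [mem_PI] at hR
  have h1 : (R.image Prod.snd).card = R.card := by
    apply card_image_of_injOn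
    rintro ⟨i, v⟩ hp ⟨i', v'⟩ hp' h
    have := hR.2 i v i' v' hp hp'
    simp_all
  have h2 : ov b R = range b \ R.image Prod.snd := by
    ext k; simp [mem_ov]
  have h3 : R.image Prod.snd ⊆ range b := by
    intro k; simp only [mem_image, mem_range]; rintro ⟨⟨i,v⟩, hp, rfl⟩; exact (hR.1 _ _ hp).2
  rw [h2, ← h1, card_sdiff_add_card_eq_card h3, card_range]

lemma row_step {K : Type*} [AddCommMonoid K] (a b : ℕ) (g : Finset (ℕ × ℕ) → K) :
    ∑ R ∈ PI (a+1) b, g R = ∑ R ∈ PI a b, (g R + ∑ v ∈ ov b R, g (insert (a,v) R)) := by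
  classical
  rw [← sum_filter_add_sum_filter_not (PI (a+1) b) (fun R => ∀ v, (a,v) ∉ R), sum_add_distrib]
  congr 1
  · apply sum_congr _ fun _ _ => rfl
    ext R
    simp only [mem_filter, mem_PI]
    constructor
    · rintro ⟨⟨h1, h2⟩, h3⟩
      refine ⟨fun i v hp => ?_, h2⟩
      have := h1 i v hp
      have : i ≠ a := by rintro rfl; exact h3 _ hp
      omega
    · rintro ⟨h1, h2⟩
      refine ⟨⟨fun i v hp => ?_, h2⟩, fun v hp => ?_⟩
      · have := h1 i v hp; omega
      · have := h1 a v hp; omega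
  · rw [sum_sigma']
    symm
    refine sum_bij (fun x _ => insert (a, x.2) x.1) ?_ ?_ ?_ ?_
    · rintro ⟨R, v⟩ h
      simp only [mem_sigma, mem_PI, mem_ov, mem_filter, mem_insert] at h ⊢
      obtain ⟨⟨h1, h2⟩, h3, h4⟩ := h
      grind
    · rintro ⟨R, v⟩ h ⟨R', v'⟩ h' e
      simp only [mem_sigma, mem_PI, mem_ov] at h h' e
      have ha : ∀ w, (a, w) ∉ R := fun w hw => by have := h.1.1 _ _ hw; omega
      have ha' : ∀ w, (a, w) ∉ R' := fun w hw => by have := h'.1.1 _ _ hw; omega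
      have hv : v = v' := by
        have : (a, v) ∈ insert (a, v') R' := e ▸ mem_insert_self _ _
        simpa [ha'] using this
      subst hv
      have : R = R' := by
        rw [← erase_insert (ha v), e, erase_insert (ha' v)]
      subst this; rfl
    · intro R h
      simp only [mem_filter, mem_PI, not_forall, not_not] at h
      obtain ⟨⟨h1, h2⟩, v, hv⟩ := h
      refine ⟨⟨R.erase (a,v), v⟩, ?_, insert_erase hv⟩
      simp only [mem_sigma, mem_PI, mem_ov, mem_erase]
      refine ⟨⟨fun i w hp => ?_, fun i v i' v' hp hp' => h2 i v i' v' hp.2 hp'.2⟩, (h1 _ _ hv).2,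
        fun i hp => ?_⟩
      · have := h1 i w hp.2
        have := h2 i w a v hp.2 hv
        have : i ≠ a := by rintro rfl; apply hp.1; simp_all
        omega
      · have := h2 i v a v hp.2 hv
        simp_all
    · intros; rfl

lemma col_step {K : Type*} [AddCommMonoid K] (a b : ℕ) (g : Finset (ℕ × ℕ) → K) :
    ∑ R ∈ PI a (b+1), g R = ∑ R ∈ PI a b, (g R + ∑ i ∈ op a R, g (insert (i,b) R)) := by
  classical
  rw [← sum_filter_add_sum_filter_not (PI a (b+1)) (fun R => ∀ i, (i,b) ∉ R), sum_add_distrib]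
  congr 1
  · apply sum_congr _ fun _ _ => rfl
    ext R
    simp only [mem_filter, mem_PI]
    constructor
    · rintro ⟨⟨h1, h2⟩, h3⟩
      refine ⟨fun i v hp => ?_, h2⟩
      have := h1 i v hp
      have : v ≠ b := by rintro rfl; exact h3 _ hp
      omega
    · rintro ⟨h1, h2⟩
      refine ⟨⟨fun i v hp => ?_, h2⟩, fun v hp => ?_⟩
      · have := h1 i v hp; omega
      · have := h1 v b hp; omega
  · rw [sum_sigma']
    symm
    refine sum_bij (fun x _ => insert (x.2, b) x.1) ?_ ?_ ?_ ?_
    · rintro ⟨R, v⟩ h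
      simp only [mem_sigma, mem_PI, mem_op, mem_filter, mem_insert] at h ⊢
      obtain ⟨⟨h1, h2⟩, h3, h4⟩ := h
      grind
    · rintro ⟨R, v⟩ h ⟨R', v'⟩ h' e
      simp only [mem_sigma, mem_PI, mem_op] at h h' e
      have ha : ∀ w, (w, b) ∉ R := fun w hw => by have := h.1.1 _ _ hw; omega
      have ha' : ∀ w, (w, b) ∉ R' := fun w hw => by have := h'.1.1 _ _ hw; omega
      have hv : v = v' := by
        have : (v, b) ∈ insert (v', b) R' := e ▸ mem_insert_self _ _
        simpa [ha'] using this
      subst hv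
      have : R = R' := by
        rw [← erase_insert (ha v), e, erase_insert (ha' v)]
      subst this; rfl
    · intro R h
      simp only [mem_filter, mem_PI, not_forall, not_not] at h
      obtain ⟨⟨h1, h2⟩, v, hv⟩ := h
      refine ⟨⟨R.erase (v,b), v⟩, ?_, insert_erase hv⟩
      simp only [mem_sigma, mem_PI, mem_op, mem_erase]
      refine ⟨⟨fun i w hp => ?_, fun i v i' v' hp hp' => h2 i v i' v' hp.2 hp'.2⟩, (h1 _ _ hv).1,
        fun i hp => ?_⟩
      · have := h1 i w hp.2
        have := h2 i w v b hp.2 hv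
        have : w ≠ b := by rintro rfl; apply hp.1; simp_all
        omega
      · have := h2 v i v b hp.2 hv
        simp_all
    · intros; rfl

open Classical in
/-- local crossing count -/
noncomputable def cc (R : Finset (ℕ × ℕ)) (p : ℕ × ℕ) : ℕ :=
  if p.1 ≤ p.2 then
    ((range (p.2+1)).filter (fun k => p.1 < k ∧ ∀ u ≤ p.2, (k,u) ∉ R)).card
  else ((range p.1).filter (fun k => p.2 < k ∧ ∀ u ≤ p.1, (u,k) ∉ R)).card

open Classical in
noncomputable def aa (m : ℕ) (R : Finset (ℕ × ℕ)) : ℕ :=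
  ((range m).filter (fun i => ∀ u < i, (i,u) ∉ R)).card

noncomputable def ee (R : Finset (ℕ × ℕ)) : ℕ := ∑ p ∈ R, cc R p

lemma cc_congr {m : ℕ} {R R' : Finset (ℕ × ℕ)} (h : ∀ i < m, ∀ v < m, (i,v) ∈ R ↔ (i,v) ∈ R')
    {p : ℕ × ℕ} (h1 : p.1 < m) (h2 : p.2 < m) : cc R p = cc R' p := by
  unfold cc
  split_ifs with hp
  · congr 1
    apply filter_congr
    intro k hk
    simp only [mem_range] at hk
    refine and_congr_right fun _ => forall_congr' fun u => forall_congr' fun hu => not_congr (h _ ?_ _ ?_) <;> omega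
  · congr 1
    apply filter_congr
    intro k hk
    simp only [mem_range] at hk
    refine and_congr_right fun _ => forall_congr' fun u => forall_congr' fun hu => not_congr (h _ ?_ _ ?_) <;> omega

lemma aa_congr {m : ℕ} {R R' : Finset (ℕ × ℕ)} (h : ∀ i < m, ∀ v < m, (i,v) ∈ R ↔ (i,v) ∈ R') :
    aa m R = aa m R' := by
  unfold aa
  congr 1
  apply filter_congr
  intro k hk
  simp only [mem_range] at hk
  refine forall_congr' fun u => forall_congr' fun hu => not_congr (h _ ?_ _ ?_) <;> omega

lemma aa_succ_pos {m : ℕ} {R R' : Finset (ℕ × ℕ)} (h : ∀ i < m, ∀ v < m, (i,v) ∈ R ↔ (i,v) ∈ R')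
    (h' : ∀ u < m, (m,u) ∉ R) : aa (m+1) R = aa m R' + 1 := by
  rw [← aa_congr h, aa, range_add_one, filter_insert, if_pos h', card_insert_of_notMem (by simp)]
  rfl

lemma aa_succ_neg {m : ℕ} {R R' : Finset (ℕ × ℕ)} (h : ∀ i < m, ∀ v < m, (i,v) ∈ R ↔ (i,v) ∈ R')
    (h' : ∃ u < m, (m,u) ∈ R) : aa (m+1) R = aa m R' := by
  rw [← aa_congr h, aa, range_add_one, filter_insert, if_neg (by push Not; exact h')]
  rfl

lemma ee_sum {m : ℕ} {R R' : Finset (ℕ × ℕ)} (hR : R ∈ PI m m)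
    (h : ∀ i < m, ∀ v < m, (i,v) ∈ R' ↔ (i,v) ∈ R) : ∑ p ∈ R, cc R' p = ee R := by
  apply sum_congr rfl
  intro p hp
  have := (mem_PI.1 hR).1 p.1 p.2 hp
  exact cc_congr h this.1 this.2

section
variable {m : ℕ} {R : Finset (ℕ × ℕ)} (hR : R ∈ PI m m)
include hR

lemma st_U : aa (m+1) R = aa m R + 1 := by
  apply aa_succ_pos (by simp)
  intro u _ h; have := (mem_PI.1 hR).1 _ _ h; omega

lemma nR1 (v : ℕ) : (m, v) ∉ R := fun h => by have := (mem_PI.1 hR).1 _ _ h; omega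
lemma nR2 (v : ℕ) : (v, m) ∉ R := fun h => by have := (mem_PI.1 hR).1 _ _ h; omega

lemma st_F : aa (m+1) (insert (m,m) R) = aa m R + 1 ∧ ee (insert (m,m) R) = ee R := by
  have h : ∀ i < m, ∀ v < m, (i,v) ∈ insert (m,m) R ↔ (i,v) ∈ R := by
    intro i hi v hv; simp; omega
  refine ⟨aa_succ_pos h fun u hu => ?_, ?_⟩
  · simp [nR1 hR]; omega
  · rw [ee, sum_insert (nR1 hR _), ee_sum hR h]
    simp only [cc, le_refl, if_true]
    rw [filter_eq_empty_iff.2]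
    · simp
    · intro k; simp; omega

lemma st_L {i : ℕ} (hi : i ∈ op m R) : aa (m+1) (insert (i,m) R) = aa m R + 1 ∧
    ee (insert (i,m) R) = ee R + (((op m R).filter (fun k => i < k)).card + 1) := by
  have hi' := mem_op.1 hi
  have h : ∀ i' < m, ∀ v < m, (i',v) ∈ insert (i,m) R ↔ (i',v) ∈ R := by
    intro i hi v hv; simp; omega
  refine ⟨aa_succ_pos h fun u hu => ?_, ?_⟩
  · simp [nR1 hR]; omega
  · rw [ee, sum_insert (nR2 hR _), ee_sum hR h, add_comm]
    congr 1
    simp only [cc, hi'.1.le, if_true]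
    rw [← card_insert_of_notMem (a := m) (by simp [mem_op])]
    congr 1
    ext k
    simp only [mem_filter, mem_insert, mem_op, mem_range, Prod.mk.injEq, not_or]
    constructor
    · rintro ⟨h1, h2, h3⟩
      by_cases hk : k = m
      · exact Or.inl hk
      · refine Or.inr ⟨⟨by omega, fun v hv => ?_⟩, h2⟩
        have := (mem_PI.1 hR).1 _ _ hv
        exact (h3 v (by omega)).2 hv
    · rintro (rfl | ⟨⟨h1, h2⟩, h3⟩)
      · exact ⟨by omega, by omega, fun u hu => ⟨by omega, nR1 hR _⟩⟩
      · exact ⟨by omega, by omega, fun u hu => ⟨by omega, h2 _⟩⟩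

lemma st_V {v : ℕ} (hv : v ∈ ov m R) : aa (m+1) (insert (m,v) R) = aa m R ∧
    ee (insert (m,v) R) = ee R + ((ov m R).filter (fun k => v < k)).card := by
  have hv' := mem_ov.1 hv
  have h : ∀ i' < m, ∀ v' < m, (i',v') ∈ insert (m,v) R ↔ (i',v') ∈ R := by
    intro i hi v hv; simp; omega
  refine ⟨aa_succ_neg h ⟨v, hv'.1, by simp⟩, ?_⟩
  · rw [ee, sum_insert (nR1 hR _), ee_sum hR h, add_comm]
    congr 1
    simp only [cc, hv'.1.not_ge, if_false]
    congr 1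
    ext k
    simp only [mem_filter, mem_insert, mem_ov, mem_range, Prod.mk.injEq, not_or]
    constructor
    · rintro ⟨h1, h2, h3⟩
      refine ⟨⟨by omega, fun v hv => ?_⟩, h2⟩
      have := (mem_PI.1 hR).1 _ _ hv
      exact (h3 v (by omega)).2 hv
    · rintro ⟨⟨h1, h2⟩, h3⟩
      exact ⟨by omega, by omega, fun u hu => ⟨by omega, h2 _⟩⟩

lemma st_D {i v : ℕ} (hi : i ∈ op m R) (hv : v ∈ ov m R) :
    aa (m+1) (insert (i,m) (insert (m,v) R)) = aa m R ∧
    ee (insert (i,m) (insert (m,v) R)) = ee R + ((ov m R).filter (fun k => v < k)).card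
      + ((op m R).filter (fun k => i < k)).card := by
  have hv' := mem_ov.1 hv
  have hi' := mem_op.1 hi
  have h : ∀ i' < m, ∀ v' < m, (i',v') ∈ (insert (i,m) (insert (m,v) R)) ↔ (i',v') ∈ R := by
    intro i' hi v' hv
    simp [show v' ≠ m by omega, show i' ≠ m by omega]
  refine ⟨aa_succ_neg h ⟨v, hv'.1, by simp⟩, ?_⟩
  rw [ee, sum_insert (by simp [nR2 hR]; omega), sum_insert (nR1 hR _), ee_sum hR h, add_comm,
    add_comm _ (ee R)]
  congr 1
  · congr 1
    simp only [cc, hv'.1.not_ge, if_false]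
    congr 1
    ext k
    simp only [mem_filter, mem_insert, mem_ov, mem_range, Prod.mk.injEq, not_or]
    constructor
    · rintro ⟨h1, h2, h3⟩
      refine ⟨⟨by omega, fun v hv => ?_⟩, h2⟩
      have := (mem_PI.1 hR).1 _ _ hv
      exact (h3 v (by omega)).2.2 hv
    · rintro ⟨⟨h1, h2⟩, h3⟩
      exact ⟨by omega, by omega, fun u hu => ⟨by omega, by omega, h2 _⟩⟩
  · simp only [cc, hi'.1.le, if_true]
    congr 1
    ext k
    simp only [mem_filter, mem_insert, mem_op, mem_range, Prod.mk.injEq, not_or]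
    constructor
    · rintro ⟨h1, h2, h3⟩
      have hk : k ≠ m := by
        rintro rfl
        have := (h3 v hv'.1.le).2.1
        simp at this
      refine ⟨⟨by omega, fun v hv => ?_⟩, h2⟩
      have := (mem_PI.1 hR).1 _ _ hv
      exact (h3 v (by omega)).2.2 hv
    · rintro ⟨⟨h1, h2⟩, h3⟩
      exact ⟨by omega, by omega, fun u hu => ⟨by omega, by omega, h2 _⟩⟩

end

section
variable {K : Type*} [CommRing K] (y q : K)

def gn (h : ℕ) : K := ∑ i ∈ range h, q ^ i

lemma gn_succ (h : ℕ) : gn q (h+1) = 1 + q * gn q h := by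
  simp [gn, sum_range_succ', mul_sum, pow_succ', add_comm]

lemma gsum (S : Finset ℕ) : ∑ i ∈ S, q ^ (S.filter (fun k => i < k)).card = gn q S.card := by
  induction S using Finset.induction_on_min with
  | empty => simp [gn]
  | insert a S ha ih =>
    have hn : a ∉ S := fun h => (ha a h).false
    rw [sum_insert hn, card_insert_of_notMem hn, gn, sum_range_succ, ← gn, ← ih, add_comm]
    congr 1
    · apply sum_congr rfl
      intro i hi
      rw [filter_insert, if_neg (ha i hi).not_gt]
    · rw [filter_insert, if_neg (lt_irrefl _), filter_true_of_mem ha]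

noncomputable def T (m : ℕ) (f : ℕ → K) : K :=
  ∑ R ∈ PI m m, y ^ aa m R * q ^ ee R * f (m - R.card)

lemma T_succ (m : ℕ) (f : ℕ → K) : T y q (m+1) f = T y q m (fun h =>
    y * f (h+1) + (gn q h + y * gn q (h+1)) * f h + gn q h * gn q h * f (h-1)) := by
  unfold T
  rw [col_step, row_step]
  apply sum_congr rfl
  intro R hR
  have c1 := card_op hR
  have c2 := card_ov hR
  have o1 : op (m+1) R = insert m (op m R) := by
    ext k
    simp only [mem_insert, mem_op]
    constructor
    · rintro ⟨h1, h2⟩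
      by_cases hk : k = m
      · exact Or.inl hk
      · exact Or.inr ⟨by omega, h2⟩
    · rintro (rfl | h)
      · exact ⟨by omega, nR1 hR⟩
      · exact ⟨by omega, h.2⟩
  have o2 : ∀ v, op (m+1) (insert (m,v) R) = op m R := by
    intro v
    ext k
    simp only [mem_insert, mem_op, Prod.mk.injEq, not_or]
    constructor
    · rintro ⟨h1, h2⟩
      have := (h2 v).1
      exact ⟨by omega, fun i => (h2 i).2⟩
    · rintro ⟨h1, h2⟩
      exact ⟨by omega, fun i => ⟨by omega, h2 i⟩⟩
  obtain ⟨h, hh⟩ : ∃ h, h = m - R.card := ⟨_, rfl⟩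
  have co : (op m R).card = h := by omega
  have cv : (ov m R).card = h := by omega
  rw [o1, sum_insert (by simp [mem_op])]
  simp only [o2]
  rw [← hh]
  have e1 : m + 1 - R.card = h + 1 := by omega
  rw [st_U hR, e1, (st_F hR).1, (st_F hR).2, card_insert_of_notMem (nR1 hR _)]
  have e2 : m + 1 - (R.card + 1) = h := by omega
  rw [e2]
  have s1 : ∑ i ∈ op m R, y ^ aa (m+1) (insert (i,m) R) * q ^ ee (insert (i,m) R) *
      f (m + 1 - (insert (i,m) R).card) = y ^ aa m R * q ^ ee R * (y * q * gn q h * f h) := by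
    rw [← co, ← gsum, mul_sum, sum_mul, mul_sum]
    apply sum_congr rfl
    intro i hi
    rw [(st_L hR hi).1, (st_L hR hi).2, card_insert_of_notMem (nR2 hR _), e2, co]
    ring
  have s2 : ∀ v ∈ ov m R, (y ^ aa (m+1) (insert (m,v) R) * q ^ ee (insert (m,v) R) *
      f (m + 1 - (insert (m,v) R).card) + ∑ i ∈ op m R, y ^ aa (m+1) (insert (i,m) (insert (m,v) R))
        * q ^ ee (insert (i,m) (insert (m,v) R)) * f (m + 1 - (insert (i,m) (insert (m,v) R)).card))
       = y ^ aa m R * q ^ ee R * q ^ ((ov m R).filter (fun k => v < k)).card *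
        (f h + gn q h * f (h-1)) := by
    intro v hv
    rw [(st_V hR hv).1, (st_V hR hv).2, card_insert_of_notMem (nR1 hR _), e2, mul_add]
    congr 1
    · ring
    · rw [← co, ← gsum, sum_mul, mul_sum]
      apply sum_congr rfl
      intro i hi
      rw [(st_D hR hi hv).1, (st_D hR hi hv).2, card_insert_of_notMem,
        card_insert_of_notMem (nR1 hR _), co]
      · have : m + 1 - (R.card + 1 + 1) = h - 1 := by omega
        rw [this]; ring
      · have := mem_op.1 hi
        simp [nR2 hR]; omega
  rw [s1, sum_congr rfl s2, ← sum_mul, ← mul_sum, gsum, cv, gn_succ]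
  ring

def wt (s : Step) (h : ℤ) : K :=
  match s with
  | Step.U => y * geo q (h + 1)
  | Step.L => geo q h + y * geo q (h + 1)
  | Step.D => geo q h

def Z (n : ℕ) (f : ℤ → K) : K :=
  ∑ M : Fin n → Step, (∏ i : Fin n, wt y q (M i) (hsum M i)) * f (hsum M n)

lemma hsum_snoc_le {n : ℕ} (M : Fin n → Step) (s : Step) (i : ℕ) (hi : i ≤ n) :
    hsum (Fin.snoc M s : Fin (n+1) → Step) i = hsum M i := by
  unfold hsum
  rw [sum_filter, sum_filter, Fin.sum_univ_castSucc]
  simp [hi]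

lemma hsum_snoc_last {n : ℕ} (M : Fin n → Step) (s : Step) :
    hsum (Fin.snoc M s : Fin (n+1) → Step) (n+1) = hsum M n + s.val := by
  unfold hsum
  rw [sum_filter, sum_filter, Fin.sum_univ_castSucc]
  simp

lemma sum_step (g : Step → K) : ∑ s, g s = g .U + g .L + g .D := by
  have : (univ : Finset Step) = {Step.U, Step.L, Step.D} := by decide
  rw [this]; simp [add_assoc]

lemma Z_succ (n : ℕ) (f : ℤ → K) : Z y q (n+1) f = Z y q n (fun h =>
    wt y q .U h * f (h+1) + wt y q .L h * f h + wt y q .D h * f (h-1)) := by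
  unfold Z
  rw [← (Fin.snocEquiv (fun _ => Step)).sum_comp, Fintype.sum_prod_type_right]
  apply sum_congr rfl
  intro M _
  rw [sum_step]
  simp only [Fin.snocEquiv, Equiv.coe_fn_mk, Fin.prod_univ_castSucc, Fin.snoc_castSucc,
    Fin.snoc_last, Fin.val_castSucc, Fin.val_last, hsum_snoc_last, hsum_snoc_le _ _ _ le_rfl]
  have : ∀ s, ∏ i : Fin n, wt y q (M i) (hsum (Fin.snoc M s : Fin (n+1) → Step) i) =
      ∏ i : Fin n, wt y q (M i) (hsum M i) := by
    intro s
    apply prod_congr rfl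
    intro i _
    rw [hsum_snoc_le _ _ _ i.2.le]
  simp only [this, Step.val]
  simp only [add_zero, ← sub_eq_add_neg]
  ring

def fac (h : ℕ) : K := ∏ i ∈ range h, gn q (i+1)

lemma geo_nat (h : ℕ) : geo q (h : ℤ) = gn q h := by simp [geo, gn]
lemma geo_nat1 (h : ℕ) : geo q ((h : ℤ) + 1) = gn q (h+1) := geo_nat q (h+1)

lemma T_eq_Z (m : ℕ) : ∀ f : ℤ → K, T y q m (fun h => fac q h * f h) = Z y q m f := by
  induction m with
  | zero =>
    intro f
    have : PI 0 0 = {∅} := by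
      ext R; rw [mem_PI]; simp [Finset.eq_empty_iff_forall_notMem]
      grind
    simp [T, Z, this, fac, aa, ee, hsum]
  | succ m ih =>
    intro f
    rw [T_succ, Z_succ, ← ih]
    congr 1
    funext h
    simp only [wt, geo_nat, geo_nat1]
    cases h with
    | zero => simp [fac, gn]
    | succ h =>
      simp only [fac, prod_range_succ, Nat.add_sub_cancel]
      push_cast
      simp only [add_sub_cancel_right]
      ring

lemma hsum_succ {n : ℕ} (M : Fin n → Step) (i : Fin n) :
    hsum M (i+1) = hsum M i + (M i).val := by
  unfold hsum
  have : univ.filter (fun j : Fin n => (j:ℕ) < i + 1) =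
      insert i (univ.filter (fun j : Fin n => (j:ℕ) < i)) := by
    ext j; simp [Fin.ext_iff]; omega
  rw [this, sum_insert (by simp), add_comm]

lemma nonneg_of_prod {n : ℕ} (M : Fin n → Step) (h : ∏ i : Fin n, wt y q (M i) (hsum M i) ≠ 0) :
    ∀ i ≤ n, 0 ≤ hsum M i := by
  intro i
  induction i with
  | zero => intro _; simp [hsum]
  | succ i ih =>
    intro hi
    have h0 := ih (by omega)
    have e := hsum_succ M ⟨i, hi⟩
    simp only at e
    rw [e]
    have hw : wt y q (M ⟨i, hi⟩) (hsum M i) ≠ 0 := fun h' => h (prod_eq_zero (mem_univ ⟨i, hi⟩) h')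
    cases hM : M ⟨i, hi⟩ with
    | U => simp [Step.val]; omega
    | L => simp [Step.val]; omega
    | D =>
      rw [hM] at hw
      have : hsum M i ≠ 0 := by
        intro h'; rw [h'] at hw; simp [wt, geo] at hw
      simp [Step.val]; omega

lemma Z_motzkin (n : ℕ) : Z y q n (fun h => if h = 0 then 1 else 0) =
    ∑ M ∈ univ.filter (fun M : Fin n → Step => IsMotzkin M),
      ∏ i : Fin n, wt y q (M i) (hsum M i) := by
  unfold Z
  rw [sum_filter]
  apply sum_congr rfl
  intro M _
  by_cases h : hsum M n = 0
  · simp only [h, if_true, mul_one]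
    split_ifs with h1
    · rfl
    · by_contra h2
      exact h1 ⟨fun i => nonneg_of_prod y q M h2 i (by omega), h⟩
  · beta_reduce
    rw [if_neg h, if_neg fun h' => h h'.2, mul_zero]

def gr {n : ℕ} (σ : Equiv.Perm (Fin n)) : Finset (ℕ × ℕ) :=
  univ.image (fun i : Fin n => ((i : ℕ), ((σ i : Fin n) : ℕ)))

lemma mem_gr {n : ℕ} (σ : Equiv.Perm (Fin n)) {a b : ℕ} :
    (a,b) ∈ gr σ ↔ ∃ i : Fin n, (i : ℕ) = a ∧ (σ i : ℕ) = b := by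
  simp [gr]

lemma mem_gr' {n : ℕ} (σ : Equiv.Perm (Fin n)) {a : Fin n} {b : ℕ} :
    ((a:ℕ),b) ∈ gr σ ↔ (σ a : ℕ) = b := by
  rw [mem_gr]
  constructor
  · rintro ⟨i, hi, h⟩; rwa [← Fin.ext hi]
  · intro h; exact ⟨a, rfl, h⟩

lemma gr_PI {n : ℕ} (σ : Equiv.Perm (Fin n)) : gr σ ∈ PI n n := by
  rw [mem_PI]
  constructor
  · intro i v h
    obtain ⟨i, rfl, rfl⟩ := (mem_gr σ).1 h
    omega
  · intro i v i' v' h h'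
    obtain ⟨i, rfl, rfl⟩ := (mem_gr σ).1 h
    obtain ⟨j, rfl, rfl⟩ := (mem_gr σ).1 h'
    simp [← Fin.ext_iff]

lemma gr_inj0 {n : ℕ} (σ : Equiv.Perm (Fin n)) : Function.Injective
    (fun i : Fin n => ((i : ℕ), ((σ i : Fin n) : ℕ))) := by
  intro i j h
  simp only [Prod.mk.injEq] at h
  exact Fin.ext h.1

lemma gr_card {n : ℕ} (σ : Equiv.Perm (Fin n)) : (gr σ).card = n := by
  rw [gr, card_image_of_injective _ (gr_inj0 σ), card_univ, Fintype.card_fin]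

lemma card_fin_range {n : ℕ} (P : ℕ → Prop) [DecidablePred P] (s : Finset ℕ)
    (hs : ∀ k, k ∈ s ↔ k < n ∧ P k) :
    s.card = (univ.filter (fun i : Fin n => P i)).card := by
  rw [← card_map Fin.valEmbedding]
  congr 1
  ext k
  simp only [hs, mem_map, mem_filter, mem_univ, true_and, Fin.valEmbedding_apply]
  constructor
  · rintro ⟨h1, h2⟩; exact ⟨⟨k, h1⟩, h2, rfl⟩
  · rintro ⟨i, h, rfl⟩; exact ⟨i.2, h⟩

lemma gr_aa {n : ℕ} (σ : Equiv.Perm (Fin n)) : aa n (gr σ) = wex σ := by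
  classical
  rw [aa, wex, card_fin_range (n := n) (fun i => ∀ u < i, (i,u) ∉ gr σ) _ (by simp)]
  congr 1
  apply filter_congr
  intro i _
  simp only [mem_gr', Fin.le_def]
  constructor
  · intro h; by_contra h'; exact h _ (by omega) rfl
  · intro h u hu; omega

lemma gr_ee {n : ℕ} (σ : Equiv.Perm (Fin n)) : ee (gr σ) = croPerm σ := by
  classical
  have h0 : ee (gr σ) = ∑ i : Fin n, cc (gr σ) ((i:ℕ), (σ i : ℕ)) :=
    sum_image (f := cc (gr σ)) (gr_inj0 σ).injOn
  rw [h0]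
  have hu : ∀ i : Fin n, cc (gr σ) ((i:ℕ), (σ i : ℕ)) =
      (univ.filter fun k => i < k ∧ k ≤ σ i ∧ σ i < σ k).card +
      (univ.filter fun k => σ i < k ∧ k < i ∧ i < σ.symm k).card := by
    intro i
    unfold cc
    simp only
    split_ifs with h
    · rw [card_fin_range (n := n) (fun k => (i:ℕ) < k ∧ k ≤ (σ i : ℕ) ∧ ∀ u ≤ (σ i : ℕ), (k,u) ∉ gr σ)]
      · rw [(filter_eq_empty_iff (s := univ) (p := fun k => σ i < k ∧ k < i ∧ i < σ.symm k)).2, card_empty, add_zero]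
        · congr 1
          apply filter_congr
          intro k _
          simp only [mem_gr', Fin.lt_def, Fin.le_def]
          refine and_congr_right fun _ => and_congr_right fun _ => ?_
          constructor
          · intro h; by_contra h'; exact h _ (by omega) rfl
          · intro h u hu; omega
        · intro k _ hk
          simp only [Fin.lt_def] at hk; omega
      · intro k
        simp only [mem_filter, mem_range]
        constructor
        · rintro ⟨h1, h2, h3⟩; exact ⟨by omega, h2, by omega, h3⟩
        · rintro ⟨h1, h2, h3, h4⟩; exact ⟨by omega, h2, h4⟩
    · rw [card_fin_range (n := n) (fun k => (σ i:ℕ) < k ∧ k < (i : ℕ) ∧ ∀ u ≤ (i : ℕ), (u,k) ∉ gr σ)]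
      · rw [(filter_eq_empty_iff (s := univ) (p := fun k => i < k ∧ k ≤ σ i ∧ σ i < σ k)).2, card_empty, zero_add]
        · congr 1
          apply filter_congr
          intro k _
          simp only [Fin.lt_def]
          refine and_congr_right fun _ => and_congr_right fun _ => ?_
          constructor
          · intro h; by_contra h'
            refine h (σ.symm k) (by omega) ?_
            rw [mem_gr']; simp
          · intro h u hu h'
            obtain ⟨j, rfl, h2⟩ := (mem_gr σ).1 h'
            have : σ.symm k = j := by rw [Equiv.symm_apply_eq]; exact Fin.ext h2.symm
            rw [this] at h; omega
        · intro k _ hk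
          simp only [Fin.lt_def, Fin.le_def] at hk; omega
      · intro k
        simp only [mem_filter, mem_range]
        constructor
        · rintro ⟨h1, h2, h3⟩; exact ⟨by omega, h2, by omega, h3⟩
        · rintro ⟨h1, h2, h3, h4⟩; exact ⟨by omega, h2, h4⟩
  rw [sum_congr rfl fun i _ => hu i]
  rw [croPerm, card_filter, Fintype.sum_prod_type]
  apply sum_congr rfl
  intro i _
  rw [← card_filter, filter_or, card_union_of_disjoint]
  · congr 1
    conv_rhs => rw [← card_map σ.toEmbedding]
    congr 1
    ext k
    simp only [mem_filter, mem_map, mem_univ, true_and, Equiv.coe_toEmbedding]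
    constructor
    · rintro ⟨h1, h2, h3⟩; exact ⟨σ.symm k, by simp [h1, h2, h3], by simp⟩
    · rintro ⟨j, ⟨h1, h2, h3⟩, rfl⟩; simp [h1, h2, h3]
  · rw [disjoint_filter]
    intro k _ h1 h2
    simp only [Fin.lt_def, Fin.le_def] at h1 h2; omega

lemma perm_sum (n : ℕ) : ∑ σ : Equiv.Perm (Fin n), y ^ wex σ * q ^ croPerm σ =
    T y q n (fun h => fac q h * (if (h:ℤ) = 0 then 1 else 0)) := by
  classical
  unfold T
  have : ∀ R ∈ PI n n, y ^ aa n R * q ^ ee R * (fac q (n - R.card) *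
      (if ((n - R.card : ℕ):ℤ) = 0 then 1 else 0)) =
      if R.card = n then y ^ aa n R * q ^ ee R else 0 := by
    intro R hR
    have := card_op hR
    by_cases h : R.card = n
    · simp [h, fac]
    · rw [if_neg h, if_neg (by omega)]; simp
  rw [sum_congr rfl this, ← sum_filter]
  refine sum_bij (fun σ _ => gr σ) ?_ ?_ ?_ ?_
  · intro σ _; exact mem_filter.2 ⟨gr_PI σ, gr_card σ⟩
  · intro σ _ τ _ h
    ext i
    have h' : gr σ = gr τ := h
    have : ((i:ℕ), (σ i : ℕ)) ∈ gr τ := h' ▸ (mem_gr' σ).2 rfl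
    exact ((mem_gr' τ).1 this).symm
  · intro R hR
    obtain ⟨hR, hc⟩ := mem_filter.1 hR
    have ho := card_op hR
    have ho' : op n R = ∅ := by rw [← card_eq_zero]; omega
    obtain ⟨h1, h2⟩ := mem_PI.1 hR
    have ex : ∀ i : Fin n, ∃ v : Fin n, ((i:ℕ),(v:ℕ)) ∈ R := by
      intro i
      by_contra! hcon
      have : (i:ℕ) ∈ op n R := mem_op.2 ⟨i.2, fun v hv => hcon ⟨v, (h1 _ _ hv).2⟩ hv⟩
      simp [ho'] at this
    choose f hf using ex
    have fi : Function.Injective f := by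
      intro i j hij
      exact Fin.ext ((h2 _ _ _ _ (hf i) (hf j)).2 (by rw [hij]))
    refine ⟨Equiv.ofBijective f (Finite.injective_iff_bijective.1 fi), mem_univ _, ?_⟩
    apply eq_of_subset_of_card_le
    · rintro ⟨a, b⟩ h
      obtain ⟨i, rfl, rfl⟩ := (mem_gr _).1 h
      exact hf i
    · rw [hc, gr_card]
  · intro σ _
    rw [gr_aa, gr_ee]

end

end Pf

open MvPolynomial in
/-- The weak exceedance/crossing generating function of permutations equals the
weighted count of Motzkin paths with up weight `y·[h+1]_q`, level weight
`[h]_q + y·[h+1]_q`, down weight `[h]_q`.  Here `y = X 0` and `q = X 1`. -/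
theorem stmt7 (n : ℕ) :
    ∑ σ : Equiv.Perm (Fin n),
        (X 0 : MvPolynomial (Fin 2) ℤ) ^ wex σ * (X 1) ^ croPerm σ
    = ∑ M ∈ Finset.univ.filter (fun M : Fin n → Step => IsMotzkin M),
        ∏ i : Fin n,
          (match M i with
            | Step.U => (X 0 : MvPolynomial (Fin 2) ℤ) *
                geo (X 1 : MvPolynomial (Fin 2) ℤ) (hsum M (i : ℕ) + 1)
            | Step.L => geo (X 1 : MvPolynomial (Fin 2) ℤ) (hsum M (i : ℕ)) +
                (X 0) * geo (X 1 : MvPolynomial (Fin 2) ℤ) (hsum M (i : ℕ) + 1)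
            | Step.D => geo (X 1 : MvPolynomial (Fin 2) ℤ) (hsum M (i : ℕ))) := by
  rw [Pf.perm_sum, Pf.T_eq_Z _ _ n (fun h => if h = 0 then 1 else 0), Pf.Z_motzkin]
  apply Finset.sum_congr rfl
  intro M _
  apply Finset.prod_congr rfl
  intro i _
  cases h : M i <;> simp [Pf.wt]
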